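/- Let (H, α) be a monoidal Hom-Hopf T-coalgebra over G with bijective antipode, (M, μ) a p-Yetter–Drinfeld module over (H, α), and q ∈ G. Define on the same underlying space M (denoted ^qM, with elements written ^qm) the H_{qpq^{-1}}-action h ⇀ ^qm = ^q(π_{q^{-1}}(h)·m) for h ∈ H_{qpq^{-1}}, and the coactions ρ^{^qM}_r(^qm) = ^q(m_{(0)}) ⊗ π_q(m_{(1,q^{-1}rq)}) for r ∈ G. Then (^qM, μ) is a qpq^{-1}-Yetter–Drinfeld module over (H, α). -/

import Mathlib

open TensorProduct

noncomputable section

section Cast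

variable (k : Type*) [Field k] {G : Type*} [Group G] {H : G → Type*}
  [∀ p, AddCommGroup (H p)] [∀ p, Module k (H p)]

/-- Transport of components along an equality of group elements. -/
def cst {a b : G} (h : a = b) : H a →ₗ[k] H b := by subst h; exact LinearMap.id

/-- Transport of components along an equality of group elements, as a linear equivalence. -/
def cstE {a b : G} (h : a = b) : H a ≃ₗ[k] H b := by subst h; exact LinearEquiv.refl k (H a)

end Cast

/-- A (classical) Hopf group-coalgebra over a group `G`. -/
structure HopfGC (k : Type*) [Field k] (G : Type*) [Group G] (H : G → Type*)
    [∀ p, AddCommGroup (H p)] [∀ p, Module k (H p)] where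
  mul : ∀ p : G, H p →ₗ[k] H p →ₗ[k] H p
  one : ∀ p : G, H p
  comul : ∀ p q : G, H (p * q) →ₗ[k] H p ⊗[k] H q
  counit : H (1 : G) →ₗ[k] k
  antipode : ∀ p : G, H p →ₗ[k] H p⁻¹
  mul_assoc' : ∀ (p : G) (a b c : H p), mul p (mul p a b) c = mul p a (mul p b c)
  one_mul' : ∀ (p : G) (a : H p), mul p (one p) a = a
  mul_one' : ∀ (p : G) (a : H p), mul p a (one p) = a
  coassoc : ∀ p q r : G,
    (TensorProduct.assoc k (H p) (H q) (H r)).toLinearMap.comp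
      ((TensorProduct.map (comul p q) LinearMap.id).comp (comul (p * q) r))
    = (TensorProduct.map LinearMap.id (comul q r)).comp
        ((comul p (q * r)).comp (cst k (mul_assoc p q r)))
  counit_comul' : ∀ (p : G) (c : H p),
    (TensorProduct.lid k (H p))
      ((TensorProduct.map counit LinearMap.id) (comul 1 p (cst k (one_mul p).symm c))) = c
  comul_counit' : ∀ (p : G) (c : H p),
    (TensorProduct.rid k (H p))
      ((TensorProduct.map LinearMap.id counit) (comul p 1 (cst k (mul_one p).symm c))) = c
  comul_mul : ∀ (p q : G) (a b : H (p * q)),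
    comul p q (mul (p * q) a b)
      = TensorProduct.map₂ (mul p) (mul q) (comul p q a) (comul p q b)
  comul_one : ∀ p q : G, comul p q (one (p * q)) = (one p) ⊗ₜ[k] (one q)
  counit_mul : ∀ a b : H (1 : G), counit (mul 1 a b) = counit a * counit b
  counit_one : counit (one 1) = 1
  antipode_left : ∀ (p : G) (h : H (1 : G)),
    TensorProduct.lift (mul p)
      ((TensorProduct.map ((cst k (inv_inv p)).comp (antipode p⁻¹)) LinearMap.id)
        (comul p⁻¹ p (cst k (show (1 : G) = p⁻¹ * p by group) h)))
    = counit h • one p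
  antipode_right : ∀ (p : G) (h : H (1 : G)),
    TensorProduct.lift (mul p)
      ((TensorProduct.map LinearMap.id ((cst k (inv_inv p)).comp (antipode p⁻¹)))
        (comul p p⁻¹ (cst k (show (1 : G) = p * p⁻¹ by group) h)))
    = counit h • one p

/-- An automorphism of a Hopf group-coalgebra. -/
structure HopfGCAut {k : Type*} [Field k] {G : Type*} [Group G] {H : G → Type*}
    [∀ p, AddCommGroup (H p)] [∀ p, Module k (H p)] (D : HopfGC k G H) where
  α : ∀ p : G, H p ≃ₗ[k] H p
  map_mul : ∀ (p : G) (a b : H p), α p (D.mul p a b) = D.mul p (α p a) (α p b)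
  map_one : ∀ p : G, α p (D.one p) = D.one p
  map_comul : ∀ (p q : G) (c : H (p * q)),
    TensorProduct.map (α p).toLinearMap (α q).toLinearMap (D.comul p q c)
      = D.comul p q (α (p * q) c)
  map_counit : ∀ c : H (1 : G), D.counit (α 1 c) = D.counit c
  map_antipode : ∀ (p : G) (h : H p), D.antipode p (α p h) = α p⁻¹ (D.antipode p h)

/-- The axioms of a group-cograded monoidal Hom-Hopf algebra, for given structure data. -/
structure IsGCHH (k : Type*) [Field k] {G : Type*} [Group G] {H : G → Type*}
    [∀ p, AddCommGroup (H p)] [∀ p, Module k (H p)]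
    (mul : ∀ p : G, H p →ₗ[k] H p →ₗ[k] H p) (one : ∀ p : G, H p)
    (comul : ∀ p q : G, H (p * q) →ₗ[k] H p ⊗[k] H q) (counit : H (1 : G) →ₗ[k] k)
    (antipode : ∀ p : G, H p →ₗ[k] H p⁻¹) (α : ∀ p : G, H p ≃ₗ[k] H p) : Prop where
  hom_assoc : ∀ (p : G) (a b c : H p), mul p (α p a) (mul p b c) = mul p (mul p a b) (α p c)
  one_mul' : ∀ (p : G) (a : H p), mul p (one p) a = α p a
  mul_one' : ∀ (p : G) (a : H p), mul p a (one p) = α p a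
  α_mul : ∀ (p : G) (a b : H p), α p (mul p a b) = mul p (α p a) (α p b)
  α_one : ∀ p : G, α p (one p) = one p
  hcoassoc : ∀ p q r : G,
    (TensorProduct.map (α p).symm.toLinearMap (comul q r)).comp
      ((comul p (q * r)).comp (cst k (mul_assoc p q r)))
    = (TensorProduct.assoc k (H p) (H q) (H r)).toLinearMap.comp
        ((TensorProduct.map (comul p q) (α r).symm.toLinearMap).comp (comul (p * q) r))
  counit_comul' : ∀ (p : G) (c : H p),
    (TensorProduct.lid k (H p))
      ((TensorProduct.map counit LinearMap.id) (comul 1 p (cst k (one_mul p).symm c)))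
    = (α p).symm c
  comul_counit' : ∀ (p : G) (c : H p),
    (TensorProduct.rid k (H p))
      ((TensorProduct.map LinearMap.id counit) (comul p 1 (cst k (mul_one p).symm c)))
    = (α p).symm c
  comul_αinv : ∀ (p q : G) (c : H (p * q)),
    comul p q ((α (p * q)).symm c)
      = TensorProduct.map (α p).symm.toLinearMap (α q).symm.toLinearMap (comul p q c)
  counit_αinv : ∀ c : H (1 : G), counit ((α 1).symm c) = counit c
  comul_mul : ∀ (p q : G) (a b : H (p * q)),
    comul p q (mul (p * q) a b)
      = TensorProduct.map₂ (mul p) (mul q) (comul p q a) (comul p q b)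
  comul_one : ∀ p q : G, comul p q (one (p * q)) = (one p) ⊗ₜ[k] (one q)
  counit_mul : ∀ a b : H (1 : G), counit (mul 1 a b) = counit a * counit b
  counit_one : counit (one 1) = 1
  antipode_α : ∀ (p : G) (h : H p), antipode p (α p h) = (α p⁻¹) (antipode p h)
  antipode_left : ∀ (p : G) (h : H (1 : G)),
    TensorProduct.lift (mul p)
      ((TensorProduct.map ((cst k (inv_inv p)).comp (antipode p⁻¹)) LinearMap.id)
        (comul p⁻¹ p (cst k (show (1 : G) = p⁻¹ * p by group) h)))
    = counit h • one p
  antipode_right : ∀ (p : G) (h : H (1 : G)),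
    TensorProduct.lift (mul p)
      ((TensorProduct.map LinearMap.id ((cst k (inv_inv p)).comp (antipode p⁻¹)))
        (comul p p⁻¹ (cst k (show (1 : G) = p * p⁻¹ by group) h)))
    = counit h • one p

/-- The axioms of a crossing on a group-cograded (monoidal Hom-)Hopf algebra. -/
structure IsCrossing (k : Type*) [Field k] {G : Type*} [Group G] {H : G → Type*}
    [∀ p, AddCommGroup (H p)] [∀ p, Module k (H p)]
    (mul : ∀ p : G, H p →ₗ[k] H p →ₗ[k] H p) (one : ∀ p : G, H p)
    (comul : ∀ p q : G, H (p * q) →ₗ[k] H p ⊗[k] H q) (counit : H (1 : G) →ₗ[k] k)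
    (α : ∀ p : G, H p ≃ₗ[k] H p)
    (π : ∀ q p : G, H p ≃ₗ[k] H (q * p * q⁻¹)) : Prop where
  π_mul : ∀ (q p : G) (a b : H p),
    π q p (mul p a b) = mul (q * p * q⁻¹) (π q p a) (π q p b)
  π_one : ∀ q p : G, π q p (one p) = one (q * p * q⁻¹)
  π_α : ∀ (q p : G) (a : H p), π q p (α p a) = α (q * p * q⁻¹) (π q p a)
  π_comul : ∀ (q a b : G) (c : H (a * b)),
    TensorProduct.map (π q a).toLinearMap (π q b).toLinearMap (comul a b c)
      = comul (q * a * q⁻¹) (q * b * q⁻¹)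
          (cst k (show q * (a * b) * q⁻¹ = (q * a * q⁻¹) * (q * b * q⁻¹) by group) (π q (a * b) c))
  π_counit : ∀ (q : G) (c : H (1 : G)),
    counit (cst k (show q * (1 : G) * q⁻¹ = 1 by group) (π q 1 c)) = counit c
  π_mult : ∀ (a b p : G) (c : H p),
    cst k (show (a * b) * p * (a * b)⁻¹ = a * (b * p * b⁻¹) * a⁻¹ by group) (π (a * b) p c)
      = π a (b * p * b⁻¹) (π b p c)

/-- A (classical) Hopf `T`-coalgebra: a Hopf group-coalgebra with a crossing. -/
structure HopfTC (k : Type*) [Field k] (G : Type*) [Group G] (H : G → Type*)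
    [∀ p, AddCommGroup (H p)] [∀ p, Module k (H p)] extends HopfGC k G H where
  π : ∀ q p : G, H p ≃ₗ[k] H (q * p * q⁻¹)
  π_mul : ∀ (q p : G) (a b : H p),
    π q p (mul p a b) = mul (q * p * q⁻¹) (π q p a) (π q p b)
  π_one : ∀ q p : G, π q p (one p) = one (q * p * q⁻¹)
  π_comul : ∀ (q a b : G) (c : H (a * b)),
    TensorProduct.map (π q a).toLinearMap (π q b).toLinearMap (comul a b c)
      = comul (q * a * q⁻¹) (q * b * q⁻¹)
          (cst k (show q * (a * b) * q⁻¹ = (q * a * q⁻¹) * (q * b * q⁻¹) by group) (π q (a * b) c))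
  π_counit : ∀ (q : G) (c : H (1 : G)),
    counit (cst k (show q * (1 : G) * q⁻¹ = 1 by group) (π q 1 c)) = counit c
  π_antipode : ∀ (q p : G) (h : H p),
    antipode (q * p * q⁻¹) (π q p h)
      = cst k (show q * p⁻¹ * q⁻¹ = (q * p * q⁻¹)⁻¹ by group) (π q p⁻¹ (antipode p h))
  π_mult : ∀ (a b p : G) (c : H p),
    cst k (show (a * b) * p * (a * b)⁻¹ = a * (b * p * b⁻¹) * a⁻¹ by group) (π (a * b) p c)
      = π a (b * p * b⁻¹) (π b p c)

/-- A group-cograded monoidal Hom-Hopf algebra (bundled data). -/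
structure GCHH (k : Type*) [Field k] (G : Type*) [Group G] (H : G → Type*)
    [∀ p, AddCommGroup (H p)] [∀ p, Module k (H p)] where
  mul : ∀ p : G, H p →ₗ[k] H p →ₗ[k] H p
  one : ∀ p : G, H p
  comul : ∀ p q : G, H (p * q) →ₗ[k] H p ⊗[k] H q
  counit : H (1 : G) →ₗ[k] k
  antipode : ∀ p : G, H p →ₗ[k] H p⁻¹
  α : ∀ p : G, H p ≃ₗ[k] H p
  ax : IsGCHH k mul one comul counit antipode α

/-- A monoidal Hom-Hopf `T`-coalgebra with bijective antipode (bundled data). -/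
structure HomTC (k : Type*) [Field k] (G : Type*) [Group G] (H : G → Type*)
    [∀ p, AddCommGroup (H p)] [∀ p, Module k (H p)] where
  mul : ∀ p : G, H p →ₗ[k] H p →ₗ[k] H p
  one : ∀ p : G, H p
  comul : ∀ p q : G, H (p * q) →ₗ[k] H p ⊗[k] H q
  counit : H (1 : G) →ₗ[k] k
  antipode : ∀ p : G, H p ≃ₗ[k] H p⁻¹
  α : ∀ p : G, H p ≃ₗ[k] H p
  π : ∀ q p : G, H p ≃ₗ[k] H (q * p * q⁻¹)
  ax : IsGCHH k mul one comul counit (fun p => (antipode p).toLinearMap) α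
  cax : IsCrossing k mul one comul counit α π

section YD

variable {k : Type*} [Field k] {G : Type*} [Group G] {H : G → Type*}
  [∀ p, AddCommGroup (H p)] [∀ p, Module k (H p)]

variable (k)

/-- The Yetter-Drinfeld compatibility condition (3) of Definition 4.1. -/
def YDcompat (T : HomTC k G H) (p : G) {M : Type*} [AddCommGroup M] [Module k M]
    (μ : M ≃ₗ[k] M) (act : H p →ₗ[k] M →ₗ[k] M)
    (ρ : ∀ r : G, M →ₗ[k] M ⊗[k] H r) : Prop :=
  ∀ r : G,
    (TensorProduct.map (TensorProduct.lift act) (TensorProduct.lift (T.mul r))).comp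
      ((TensorProduct.tensorTensorTensorComm k (H p) (H r) M (H r)).toLinearMap.comp
        (TensorProduct.map (T.comul p r) (ρ r)))
    =
    (TensorProduct.map μ.toLinearMap (TensorProduct.lift (T.mul r))).comp
      ((TensorProduct.assoc k M (H r) (H r)).toLinearMap.comp
        (((TensorProduct.comm k (H r) (M ⊗[k] H r)).toLinearMap).comp
          ((TensorProduct.map
              ((cst k (show p⁻¹ * (p * r * p⁻¹) * p⁻¹⁻¹ = r by group)).comp
                (T.π p⁻¹ (p * r * p⁻¹)).toLinearMap)
              ((ρ r).comp (TensorProduct.lift act))).comp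
            ((TensorProduct.assoc k (H (p * r * p⁻¹)) (H p) M).toLinearMap.comp
              (TensorProduct.map
                ((T.comul (p * r * p⁻¹) p).comp
                  (cst k (show p * r = (p * r * p⁻¹) * p by group)))
                μ.symm.toLinearMap)))))

/-- The axioms of a (left-right) `p`-Yetter-Drinfeld module over a monoidal Hom-Hopf
`T`-coalgebra. -/
structure IsYD (T : HomTC k G H) (p : G) {M : Type*} [AddCommGroup M] [Module k M]
    (μ : M ≃ₗ[k] M) (act : H p →ₗ[k] M →ₗ[k] M)
    (ρ : ∀ r : G, M →ₗ[k] M ⊗[k] H r) : Prop where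
  act_act : ∀ (a b : H p) (m : M), act (T.α p a) (act b m) = act (T.mul p a b) (μ m)
  act_one : ∀ m : M, act (T.one p) m = μ m
  μ_act : ∀ (a : H p) (m : M), μ (act a m) = act (T.α p a) (μ m)
  ρ_coassoc : ∀ a b : G,
    (TensorProduct.map μ.symm.toLinearMap (T.comul a b)).comp (ρ (a * b))
    = (TensorProduct.assoc k M (H a) (H b)).toLinearMap.comp
        ((TensorProduct.map (ρ a) (T.α b).symm.toLinearMap).comp (ρ b))
  ρ_counit : ∀ m : M,
    (TensorProduct.rid k M) ((TensorProduct.map LinearMap.id T.counit) (ρ 1 m)) = μ.symm m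
  ρ_μ : ∀ r : G,
    (ρ r).comp μ.toLinearMap
      = (TensorProduct.map μ.toLinearMap (T.α r).toLinearMap).comp (ρ r)
  compat : YDcompat k T p μ act ρ

/-- The action of `H (a*b)` on a tensor product of an `H a`-module and an `H b`-module. -/
def tAct (T : HomTC k G H) (a b : G) {M N : Type*} [AddCommGroup M] [Module k M]
    [AddCommGroup N] [Module k N]
    (actM : H a →ₗ[k] M →ₗ[k] M) (actN : H b →ₗ[k] N →ₗ[k] N) :
    H (a * b) →ₗ[k] (M ⊗[k] N) →ₗ[k] (M ⊗[k] N) :=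
  (TensorProduct.map₂ actM actN).comp (T.comul a b)

/-- The coaction on the tensor product `M ⊗ N`, where `N` has degree `b`:
`ρ r (m ⊗ n) = m₍₀₎ ⊗ n₍₀₎ ⊗ n₍₁,r₎ ⬝ π_{b⁻¹}(m₍₁,brb⁻¹₎)`. -/
def tCoact (T : HomTC k G H) (b : G) {M N : Type*} [AddCommGroup M] [Module k M]
    [AddCommGroup N] [Module k N]
    (ρM : ∀ r : G, M →ₗ[k] M ⊗[k] H r) (ρN : ∀ r : G, N →ₗ[k] N ⊗[k] H r) (r : G) :
    (M ⊗[k] N) →ₗ[k] (M ⊗[k] N) ⊗[k] H r :=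
  (TensorProduct.map LinearMap.id
      (TensorProduct.lift (((T.mul r).flip).comp
        ((cst k (show b⁻¹ * (b * r * b⁻¹) * b⁻¹⁻¹ = r by group)).comp
          (T.π b⁻¹ (b * r * b⁻¹)).toLinearMap)))).comp
    ((TensorProduct.tensorTensorTensorComm k M (H (b * r * b⁻¹)) N (H r)).toLinearMap.comp
      (TensorProduct.map (ρM (b * r * b⁻¹)) (ρN r)))

/-- The conjugate action on `ᵠM`: `h ⇀ m = π_{s⁻¹}(h) ⬝ m`. -/
def cAct (T : HomTC k G H) (s p : G) {M : Type*} [AddCommGroup M] [Module k M]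
    (act : H p →ₗ[k] M →ₗ[k] M) : H (s * p * s⁻¹) →ₗ[k] M →ₗ[k] M :=
  act.comp ((cst k (show s⁻¹ * (s * p * s⁻¹) * s⁻¹⁻¹ = p by group)).comp
    (T.π s⁻¹ (s * p * s⁻¹)).toLinearMap)

/-- The conjugate coaction on `ˢM`: `ρ r m = m₍₀₎ ⊗ π_s (m₍₁,s⁻¹rs₎)`. -/
def cCoact (T : HomTC k G H) (s : G) {M : Type*} [AddCommGroup M] [Module k M]
    (ρ : ∀ r : G, M →ₗ[k] M ⊗[k] H r) (r : G) : M →ₗ[k] M ⊗[k] H r :=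
  (TensorProduct.map LinearMap.id
      ((cst k (show s * (s⁻¹ * r * s) * s⁻¹ = r by group)).comp
        (T.π s (s⁻¹ * r * s)).toLinearMap)).comp
    (ρ (s⁻¹ * r * s))

/-- The Hom-associator `(A ⊗ B) ⊗ C ≃ A ⊗ (B ⊗ C)`, `(a ⊗ b) ⊗ c ↦ φA a ⊗ (b ⊗ φC⁻¹ c)`. -/
def homAssoc {A B C : Type*} [AddCommGroup A] [Module k A] [AddCommGroup B] [Module k B]
    [AddCommGroup C] [Module k C] (φA : A ≃ₗ[k] A) (φC : C ≃ₗ[k] C) :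
    (A ⊗[k] B) ⊗[k] C ≃ₗ[k] A ⊗[k] (B ⊗[k] C) :=
  (TensorProduct.assoc k A B C).trans
    (TensorProduct.congr φA (TensorProduct.congr (LinearEquiv.refl k B) φC.symm))

/-- The braiding `c_{M,W} : M ⊗ W → ᴹW ⊗ M`,
`m ⊗ w ↦ (S_{w⁻¹}(m₍₁,w⁻¹₎) ⬝ φW⁻¹ w) ⊗ μ m₍₀₎`, where `W` has degree `w`. -/
def braid (T : HomTC k G H) (w : G) {M W : Type*} [AddCommGroup M] [Module k M]
    [AddCommGroup W] [Module k W] (μ : M ≃ₗ[k] M) (ρM : ∀ r : G, M →ₗ[k] M ⊗[k] H r)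
    (actW : H w →ₗ[k] W →ₗ[k] W) (φW : W ≃ₗ[k] W) : (M ⊗[k] W) →ₗ[k] (W ⊗[k] M) :=
  (TensorProduct.comm k M W).toLinearMap.comp
    ((TensorProduct.map μ.toLinearMap
        (TensorProduct.lift (actW.comp
          ((cst k (inv_inv w)).comp (T.antipode w⁻¹).toLinearMap)))).comp
      ((TensorProduct.assoc k M (H w⁻¹) W).toLinearMap.comp
        (TensorProduct.map (ρM w⁻¹) φW.symm.toLinearMap)))

end YD

/-- The axioms of a monoidal Hom-Hopf algebra on a single space. -/
structure IsMonHomHopf (k : Type*) [Field k] (A : Type*) [AddCommGroup A] [Module k A]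
    (mul : A →ₗ[k] A →ₗ[k] A) (one : A) (comul : A →ₗ[k] A ⊗[k] A) (counit : A →ₗ[k] k)
    (S : A →ₗ[k] A) (α : A ≃ₗ[k] A) : Prop where
  hom_assoc : ∀ a b c : A, mul (α a) (mul b c) = mul (mul a b) (α c)
  one_mul' : ∀ a : A, mul one a = α a
  mul_one' : ∀ a : A, mul a one = α a
  α_mul : ∀ a b : A, α (mul a b) = mul (α a) (α b)
  α_one : α one = one
  hcoassoc :
    (TensorProduct.map α.symm.toLinearMap comul).comp comul
    = (TensorProduct.assoc k A A A).toLinearMap.comp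
        ((TensorProduct.map comul α.symm.toLinearMap).comp comul)
  counit_comul' : ∀ a : A,
    (TensorProduct.lid k A) ((TensorProduct.map counit LinearMap.id) (comul a)) = α.symm a
  comul_counit' : ∀ a : A,
    (TensorProduct.rid k A) ((TensorProduct.map LinearMap.id counit) (comul a)) = α.symm a
  comul_αinv : ∀ a : A,
    comul (α.symm a) = TensorProduct.map α.symm.toLinearMap α.symm.toLinearMap (comul a)
  counit_αinv : ∀ a : A, counit (α.symm a) = counit a
  comul_mul : ∀ a b : A, comul (mul a b) = TensorProduct.map₂ mul mul (comul a) (comul b)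
  comul_one : comul one = one ⊗ₜ[k] one
  counit_mul : ∀ a b : A, counit (mul a b) = counit a * counit b
  counit_one : counit one = 1
  antipode_α : ∀ a : A, S (α a) = α (S a)
  antipode_left : ∀ a : A,
    TensorProduct.lift mul ((TensorProduct.map S LinearMap.id) (comul a)) = counit a • one
  antipode_right : ∀ a : A,
    TensorProduct.lift mul ((TensorProduct.map LinearMap.id S) (comul a)) = counit a • one

section Crossing

variable {k : Type*} [Field k] {G : Type*} [Group G] {H : G → Type*}
  [∀ p, AddCommGroup (H p)] [∀ p, Module k (H p)] (T : HomTC k G H)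

/-- The crossing `π_s : H a → H b`, where `b` is any presentation of the conjugate `s a s⁻¹`. -/
def crossTo (s : G) {a b : G} (h : s * a * s⁻¹ = b) : H a →ₗ[k] H b :=
  (cst k h).comp (T.π s a).toLinearMap

lemma crossTo_mul (s : G) {a b : G} (h : s * a * s⁻¹ = b) (x y : H a) :
    crossTo T s h (T.mul a x y) = T.mul b (crossTo T s h x) (crossTo T s h y) := by
  subst h
  exact T.cax.π_mul s a x y

lemma crossTo_one (s : G) {a b : G} (h : s * a * s⁻¹ = b) :
    crossTo T s h (T.one a) = T.one b := by
  subst h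
  exact T.cax.π_one s a

lemma crossTo_α (s : G) {a b : G} (h : s * a * s⁻¹ = b) (x : H a) :
    crossTo T s h (T.α a x) = T.α b (crossTo T s h x) := by
  subst h
  exact T.cax.π_α s a x

lemma crossTo_α_symm (s : G) {a b : G} (h : s * a * s⁻¹ = b) (x : H a) :
    crossTo T s h ((T.α a).symm x) = (T.α b).symm (crossTo T s h x) := by
  rw [LinearEquiv.eq_symm_apply, ← crossTo_α, LinearEquiv.apply_symm_apply]

lemma crossTo_counit (s : G) (h : s * 1 * s⁻¹ = 1) (x : H (1 : G)) :
    T.counit (crossTo T s h x) = T.counit x :=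
  T.cax.π_counit s x

lemma crossTo_comul (s : G) {a b a' b' c : G} (ha : s * a * s⁻¹ = a') (hb : s * b * s⁻¹ = b')
    (hc : s * c * s⁻¹ = a' * b') (e : c = a * b) (x : H c) :
    T.comul a' b' (crossTo T s hc x) =
      TensorProduct.map (crossTo T s ha) (crossTo T s hb) (T.comul a b (cst k e x)) := by
  subst e ha hb
  exact (T.cax.π_comul s a b x).symm

lemma crossTo_crossTo (s t : G) {a b c : G} (h : t * a * t⁻¹ = b) (h' : s * b * s⁻¹ = c)
    (h'' : s * t * a * (s * t)⁻¹ = c) (x : H a) :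
    crossTo T s h' (crossTo T t h x) = crossTo T (s * t) h'' x := by
  subst h h'
  exact (T.cax.π_mult s t a x).symm

lemma crossTo_congr {s t : G} (e : s = t) {a b : G} (h : s * a * s⁻¹ = b)
    (h' : t * a * t⁻¹ = b) : crossTo T s h = crossTo T t h' := by
  subst e
  rfl

lemma cst_crossTo (s : G) {a b c : G} (h : s * a * s⁻¹ = b) (e : b = c) (x : H a) :
    cst k e (crossTo T s h x) = crossTo T s (h.trans e) x := by
  subst e
  rfl

lemma crossTo_injective (s : G) {a b : G} (h : s * a * s⁻¹ = b) :
    Function.Injective (crossTo T s h) := by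
  subst h
  exact (T.π s a).injective

lemma crossTo_surjective (s : G) {a b : G} (h : s * a * s⁻¹ = b) :
    Function.Surjective (crossTo T s h) := by
  subst h
  exact (T.π s a).surjective

lemma crossTo_one_left {a : G} (h : 1 * a * 1⁻¹ = a) (x : H a) :
    crossTo T 1 h x = x := by
  apply crossTo_injective T 1 h
  rw [crossTo_crossTo T 1 1 h h (by group)]
  exact LinearMap.congr_fun (crossTo_congr T (one_mul 1) _ _) x

lemma crossTo_inv_crossTo (s : G) {a b : G} (h : s * a * s⁻¹ = b) (h' : s⁻¹ * b * s⁻¹⁻¹ = a)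
    (x : H a) : crossTo T s⁻¹ h' (crossTo T s h x) = x := by
  rw [crossTo_crossTo T s⁻¹ s h h' (by group),
    crossTo_congr T (inv_mul_cancel s) _ (by group), crossTo_one_left]

variable {M : Type*} [AddCommGroup M] [Module k M]

lemma cAct_apply (s p : G) (act : H p →ₗ[k] M →ₗ[k] M)
    (h : s⁻¹ * (s * p * s⁻¹) * s⁻¹⁻¹ = p) (x : H (s * p * s⁻¹)) (m : M) :
    cAct k T s p act x m = act (crossTo T s⁻¹ h x) m :=
  rfl

lemma cAct_crossTo (s p : G) (act : H p →ₗ[k] M →ₗ[k] M) (h : s * p * s⁻¹ = s * p * s⁻¹)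
    (x : H p) (m : M) :
    cAct k T s p act (crossTo T s h x) m = act x m := by
  rw [cAct_apply T s p act (by group), crossTo_inv_crossTo]

lemma cCoact_apply (s : G) (ρ : ∀ r : G, M →ₗ[k] M ⊗[k] H r) {a r : G}
    (h : s * a * s⁻¹ = r) (m : M) :
    cCoact k T s ρ r m = TensorProduct.map LinearMap.id (crossTo T s h) (ρ a m) := by
  obtain rfl : a = s⁻¹ * r * s := by rw [← h]; group
  rfl

lemma yd_left_natural (s p r r' : G) (h : s * r' * s⁻¹ = r) (act : H p →ₗ[k] M →ₗ[k] M)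
    (x : H p ⊗[k] H r') (y : M ⊗[k] H r') :
    TensorProduct.map (TensorProduct.lift (cAct k T s p act)) (TensorProduct.lift (T.mul r))
      (TensorProduct.tensorTensorTensorComm k (H (s * p * s⁻¹)) (H r) M (H r)
        (TensorProduct.map (crossTo T s rfl) (crossTo T s h) x ⊗ₜ[k]
          TensorProduct.map LinearMap.id (crossTo T s h) y)) =
    TensorProduct.map LinearMap.id (crossTo T s h)
      (TensorProduct.map (TensorProduct.lift act) (TensorProduct.lift (T.mul r'))
        (TensorProduct.tensorTensorTensorComm k (H p) (H r') M (H r') (x ⊗ₜ[k] y))) := by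
  induction x with
  | zero => simp
  | add x₁ x₂ h₁ h₂ => simp only [map_add, TensorProduct.add_tmul, h₁, h₂]
  | tmul a b =>
    induction y with
    | zero => simp
    | add y₁ y₂ h₁ h₂ => simp only [map_add, TensorProduct.tmul_add, h₁, h₂]
    | tmul m c => simp [cAct_crossTo, crossTo_mul]

lemma mul_coact_natural (s r r' : G) (h : s * r' * s⁻¹ = r) (f : M →ₗ[k] M)
    (y : M ⊗[k] H r') (c : H r') :
    TensorProduct.map f (TensorProduct.lift (T.mul r))
      (TensorProduct.assoc k M (H r) (H r)
        (TensorProduct.map LinearMap.id (crossTo T s h) y ⊗ₜ[k] crossTo T s h c)) =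
    TensorProduct.map LinearMap.id (crossTo T s h)
      (TensorProduct.map f (TensorProduct.lift (T.mul r'))
        (TensorProduct.assoc k M (H r') (H r') (y ⊗ₜ[k] c))) := by
  induction y with
  | zero => simp
  | add y₁ y₂ h₁ h₂ => simp only [map_add, TensorProduct.add_tmul, h₁, h₂]
  | tmul m b => simp [crossTo_mul]

/-- The right-hand side of the Yetter-Drinfeld compatibility, as a function of the coproduct
of the acting element. -/
def ydRight (p r u : G) (h : p⁻¹ * u * p⁻¹⁻¹ = r) (f : M →ₗ[k] M) (act : H p →ₗ[k] M →ₗ[k] M)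
    (ρ : ∀ r : G, M →ₗ[k] M ⊗[k] H r) (x : H u ⊗[k] H p) (m : M) : M ⊗[k] H r :=
  TensorProduct.map f (TensorProduct.lift (T.mul r))
    (TensorProduct.assoc k M (H r) (H r)
      (TensorProduct.comm k (H r) (M ⊗[k] H r)
        (TensorProduct.map (crossTo T p⁻¹ h) ((ρ r).comp (TensorProduct.lift act))
          (TensorProduct.assoc k (H u) (H p) M (x ⊗ₜ[k] m)))))

lemma ydRight_natural (s p r r' u u' : G) (h : s * r' * s⁻¹ = r) (hu : s * u' * s⁻¹ = u)
    (hr' : p⁻¹ * u' * p⁻¹⁻¹ = r') (hr : (s * p * s⁻¹)⁻¹ * u * (s * p * s⁻¹)⁻¹⁻¹ = r)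
    (f : M →ₗ[k] M) (act : H p →ₗ[k] M →ₗ[k] M) (ρ : ∀ r : G, M →ₗ[k] M ⊗[k] H r)
    (x : H u' ⊗[k] H p) (m : M) :
    ydRight T (s * p * s⁻¹) r u hr f (cAct k T s p act) (cCoact k T s ρ)
      (TensorProduct.map (crossTo T s hu) (crossTo T s rfl) x) m =
    TensorProduct.map LinearMap.id (crossTo T s h) (ydRight T p r' u' hr' f act ρ x m) := by
  unfold ydRight
  induction x with
  | zero => simp
  | add x₁ x₂ h₁ h₂ => simp only [map_add, TensorProduct.add_tmul, h₁, h₂]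
  | tmul a b =>
    have key : crossTo T (s * p * s⁻¹)⁻¹ hr (crossTo T s hu a) =
        crossTo T s h (crossTo T p⁻¹ hr' a) := by
      rw [crossTo_crossTo T _ _ hu hr (by rw [← hr, ← hu]; group),
        crossTo_crossTo T _ _ hr' h (by rw [← h, ← hr']; group)]
      exact LinearMap.congr_fun (crossTo_congr T (by group) _ _) a
    simp only [TensorProduct.map_tmul, TensorProduct.assoc_tmul, TensorProduct.comm_tmul,
      LinearMap.comp_apply, TensorProduct.lift.tmul, key, cAct_crossTo,
      cCoact_apply T s ρ h, mul_coact_natural]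

lemma YDcompat.conj (p s : G) (μ : M ≃ₗ[k] M) (act : H p →ₗ[k] M →ₗ[k] M)
    (ρ : ∀ r : G, M →ₗ[k] M ⊗[k] H r) (hc : YDcompat k T p μ act ρ) :
    YDcompat k T (s * p * s⁻¹) μ (cAct k T s p act) (cCoact k T s ρ) := by
  intro r
  have h : s * (s⁻¹ * r * s) * s⁻¹ = r := by group
  have hx : s * (p * (s⁻¹ * r * s)) * s⁻¹ = s * p * s⁻¹ * r := by group
  have hu : s * (p * (s⁻¹ * r * s) * p⁻¹) * s⁻¹ = s * p * s⁻¹ * r * (s * p * s⁻¹)⁻¹ := by group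
  apply TensorProduct.ext'
  intro x m
  obtain ⟨x, rfl⟩ := crossTo_surjective T s hx x
  have base := LinearMap.congr_fun (hc (s⁻¹ * r * s)) (x ⊗ₜ[k] m)
  change _ = ydRight T p (s⁻¹ * r * s) (p * (s⁻¹ * r * s) * p⁻¹) (by group) μ.toLinearMap act ρ
    (T.comul _ p (cst k (by group) x)) (μ.symm m) at base
  change TensorProduct.map _ _ (TensorProduct.tensorTensorTensorComm k _ _ _ _
      (T.comul (s * p * s⁻¹) r (crossTo T s hx x) ⊗ₜ[k] cCoact k T s ρ r m)) =
    ydRight T (s * p * s⁻¹) r _ (by group) μ.toLinearMap (cAct k T s p act) (cCoact k T s ρ)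
      (T.comul (s * p * s⁻¹ * r * (s * p * s⁻¹)⁻¹) (s * p * s⁻¹)
        (cst k (by group) (crossTo T s hx x))) (μ.symm m)
  rw [cst_crossTo, crossTo_comul T s hu rfl _ (by group), ydRight_natural T s p r _ _ _ h hu
    (by group), ← base, crossTo_comul T s rfl h _ rfl, cCoact_apply T s ρ h, yd_left_natural]
  rfl

end Crossing

/-- The conjugate `ᵠM` of a `p`-Yetter-Drinfeld module is a
`qpq⁻¹`-Yetter-Drinfeld module. -/
theorem statement9 {k : Type*} [Field k] {G : Type*} [Group G] {H : G → Type*}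
    [∀ p, AddCommGroup (H p)] [∀ p, Module k (H p)]
    (T : HomTC k G H) (p q : G)
    (M : Type*) [AddCommGroup M] [Module k M]
    (μ : M ≃ₗ[k] M) (actM : H p →ₗ[k] M →ₗ[k] M) (ρM : ∀ r : G, M →ₗ[k] M ⊗[k] H r)
    (hM : IsYD k T p μ actM ρM) :
    IsYD k T (q * p * q⁻¹) μ (cAct k T q p actM) (cCoact k T q ρM) := by
  have hp : q⁻¹ * (q * p * q⁻¹) * q⁻¹⁻¹ = p := by group
  refine ⟨?_, ?_, ?_, ?_, ?_, ?_, hM.compat.conj T p q μ actM ρM⟩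
  · intro a b m
    simp only [cAct_apply T q p actM hp, crossTo_α, crossTo_mul, hM.act_act]
  · intro m
    rw [cAct_apply T q p actM hp, crossTo_one, hM.act_one]
  · intro a m
    rw [cAct_apply T q p actM hp, cAct_apply T q p actM hp, crossTo_α, hM.μ_act]
  · intro a b
    ext m
    have ha : q * (q⁻¹ * a * q) * q⁻¹ = a := by group
    have hb : q * (q⁻¹ * b * q) * q⁻¹ = b := by group
    have hab : q * (q⁻¹ * a * q * (q⁻¹ * b * q)) * q⁻¹ = a * b := by group
    have base := LinearMap.congr_fun (hM.ρ_coassoc (q⁻¹ * a * q) (q⁻¹ * b * q)) m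
    simp only [LinearMap.comp_apply, cCoact_apply T q ρM hab, cCoact_apply T q ρM hb] at base ⊢
    have left (y : M ⊗[k] H (q⁻¹ * a * q * (q⁻¹ * b * q))) :
        TensorProduct.map μ.symm.toLinearMap (T.comul a b)
          (TensorProduct.map LinearMap.id (crossTo T q hab) y) =
        TensorProduct.map LinearMap.id (TensorProduct.map (crossTo T q ha) (crossTo T q hb))
          (TensorProduct.map μ.symm.toLinearMap (T.comul _ _) y) := by
      induction y with
      | zero => simp
      | add y₁ y₂ h₁ h₂ => simp only [map_add, h₁, h₂]
      | tmul n c =>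
        simp only [TensorProduct.map_tmul, crossTo_comul T q ha hb hab rfl]
        rfl
    have inner (z : M ⊗[k] H (q⁻¹ * a * q)) (c : H (q⁻¹ * b * q)) :
        TensorProduct.assoc k M (H a) (H b)
          (TensorProduct.map LinearMap.id (crossTo T q ha) z ⊗ₜ[k] crossTo T q hb c) =
        TensorProduct.map LinearMap.id (TensorProduct.map (crossTo T q ha) (crossTo T q hb))
          (TensorProduct.assoc k M _ _ (z ⊗ₜ[k] c)) := by
      induction z with
      | zero => simp
      | add z₁ z₂ h₁ h₂ => simp only [map_add, TensorProduct.add_tmul, h₁, h₂]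
      | tmul n d => simp
    have right (y : M ⊗[k] H (q⁻¹ * b * q)) :
        TensorProduct.assoc k M (H a) (H b)
          (TensorProduct.map (cCoact k T q ρM a) (T.α b).symm.toLinearMap
            (TensorProduct.map LinearMap.id (crossTo T q hb) y)) =
        TensorProduct.map LinearMap.id (TensorProduct.map (crossTo T q ha) (crossTo T q hb))
          (TensorProduct.assoc k M _ _
            (TensorProduct.map (ρM _) (T.α _).symm.toLinearMap y)) := by
      induction y with
      | zero => simp
      | add y₁ y₂ h₁ h₂ => simp only [map_add, h₁, h₂]
      | tmul n c =>
        simp only [TensorProduct.map_tmul, LinearMap.id_apply, LinearEquiv.coe_coe,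
          ← crossTo_α_symm, cCoact_apply T q ρM ha, inner]
    rw [left, base]
    exact (right _).symm
  · intro m
    have h1 : q * 1 * q⁻¹ = 1 := by group
    have hc : T.counit.comp (crossTo T q h1) = T.counit :=
      LinearMap.ext (crossTo_counit T q h1)
    rw [cCoact_apply T q ρM h1, ← LinearMap.comp_apply (TensorProduct.map _ _),
      ← TensorProduct.map_comp, hc, LinearMap.id_comp, hM.ρ_counit]
  · intro r
    ext m
    have hr : q * (q⁻¹ * r * q) * q⁻¹ = r := by group
    have base := LinearMap.congr_fun (hM.ρ_μ (q⁻¹ * r * q)) m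
    simp only [LinearMap.comp_apply, LinearEquiv.coe_coe, cCoact_apply T q ρM hr] at base ⊢
    rw [base]
    generalize ρM (q⁻¹ * r * q) m = y
    induction y with
    | zero => simp
    | add y₁ y₂ h₁ h₂ => simp only [map_add, h₁, h₂]
    | tmul n c => simp [crossTo_α]
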